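/- arXiv:1410.2513 — 2 statements merged into one kernel-verified Lean document; each statement's English description precedes it below -/
import Mathlib

section
/- There are no minimal cyclic surfaces in Sol₃ foliated by arcs of circles in the totally geodesic planes x = const. Precisely: let I, J ⊆ ℝ be nonempty open intervals and let a, b, r : I → ℝ be twice continuously differentiable with r(s) > 0 and b(s) − r(s) > 0 for all s ∈ I, and define X : I × J → ℝ³ by X(s,t) = (s, a(s) + r(s)·cos t, log(b(s) + r(s)·sin t)). Then X does not have zero mean curvature, i.e. it is NOT the case that for every (s,t) ∈ I × J and every n ∈ ℝ³ with g_X(n, X_s) = g_X(n, X_t) = 0 one has E·g_X(S_tt, n) − 2F·g_X(S_st, n) + G·g_X(S_ss, n) = 0. -/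
open Real

noncomputable section

/-- Tangent/ambient vectors of Sol₃ modeled on ℝ³. -/
abbrev V3 : Type := ℝ × ℝ × ℝ

/-- The Sol₃ metric at a point `p = (x,y,z)`:
`g_p(u,v) = e^{2z}u₁v₁ + e^{-2z}u₂v₂ + u₃v₃`. -/
def gSol (p u v : V3) : ℝ :=
  exp (2 * p.2.2) * u.1 * v.1 + exp (-(2 * p.2.2)) * u.2.1 * v.2.1 + u.2.2 * v.2.2

/-- The Christoffel bilinear map of the Sol₃ metric at a point `p`. -/
def GammaSol (p u v : V3) : V3 :=
  (u.1 * v.2.2 + u.2.2 * v.1,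
   -(u.2.1 * v.2.2 + u.2.2 * v.2.1),
   -exp (2 * p.2.2) * u.1 * v.1 + exp (-(2 * p.2.2)) * u.2.1 * v.2.1)

/-- Partial derivative of a parametrized surface with respect to the first parameter. -/
def pXs (X : ℝ → ℝ → V3) (s t : ℝ) : V3 := deriv (fun s' => X s' t) s

/-- Partial derivative of a parametrized surface with respect to the second parameter. -/
def pXt (X : ℝ → ℝ → V3) (s t : ℝ) : V3 := deriv (fun t' => X s t') t

/-- Ambient second-order quantity `S_ss = X_ss + Γ_X(X_s, X_s)`. -/
def Sss (X : ℝ → ℝ → V3) (s t : ℝ) : V3 :=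
  deriv (fun s' => pXs X s' t) s + GammaSol (X s t) (pXs X s t) (pXs X s t)

/-- Ambient second-order quantity `S_st = X_st + Γ_X(X_s, X_t)`. -/
def Sst (X : ℝ → ℝ → V3) (s t : ℝ) : V3 :=
  deriv (fun t' => pXs X s t') t + GammaSol (X s t) (pXs X s t) (pXt X s t)

/-- Ambient second-order quantity `S_tt = X_tt + Γ_X(X_t, X_t)`. -/
def Stt (X : ℝ → ℝ → V3) (s t : ℝ) : V3 :=
  deriv (fun t' => pXt X s t') t + GammaSol (X s t) (pXt X s t) (pXt X s t)

/-- `X : I × J → Sol₃` has zero mean curvature: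
for every point of `I × J` and every normal vector `n`,
`E·g(S_tt,n) - 2F·g(S_st,n) + G·g(S_ss,n) = 0`. -/
def MeanZero (I J : Set ℝ) (X : ℝ → ℝ → V3) : Prop :=
  ∀ s ∈ I, ∀ t ∈ J, ∀ n : V3,
    gSol (X s t) n (pXs X s t) = 0 → gSol (X s t) n (pXt X s t) = 0 →
    gSol (X s t) (pXs X s t) (pXs X s t) * gSol (X s t) (Stt X s t) n
      - 2 * gSol (X s t) (pXs X s t) (pXt X s t) * gSol (X s t) (Sst X s t) n
      + gSol (X s t) (pXt X s t) (pXt X s t) * gSol (X s t) (Sss X s t) n = 0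

/-- `X : I × J → Sol₃` has zero Gaussian curvature:
for every point of `I × J` and every normal vector `n`,
`g(S_ss,n)·g(S_tt,n) - g(S_st,n)² = 0`. -/
def GaussZero (I J : Set ℝ) (X : ℝ → ℝ → V3) : Prop :=
  ∀ s ∈ I, ∀ t ∈ J, ∀ n : V3,
    gSol (X s t) n (pXs X s t) = 0 → gSol (X s t) n (pXt X s t) = 0 →
    gSol (X s t) (Sss X s t) n * gSol (X s t) (Stt X s t) n
      - (gSol (X s t) (Sst X s t) n) ^ 2 = 0

/-- Up to a positive factor, the mean curvature of the surface at parameter `t`, as a polynomial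
in `c = cos t` and `σ = sin t`; here `a₁, b₁, r₁` and `a₂, b₂, r₂` are the first and second
derivatives of the data `a, b, r`. -/
def meanPoly (b r a₁ b₁ r₁ a₂ b₂ r₂ c σ : ℝ) : ℝ :=
  -b * ((a₁ + r₁ * c) ^ 2 + (b₁ + r₁ * σ) ^ 2)
    + 2 * r * (b₁ * c - a₁ * σ) *
      ((a₁ * c + b₁ * σ + r₁) * c + (a₁ + r₁ * c))
    + r * (-2 * (b₁ + r₁ * σ) * (a₁ * c + b₁ * σ + r₁)
      + (a₂ * c + b₂ * σ + r₂) * (b + r * σ)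
      - 2 * (a₁ + r₁ * c) * (b₁ + r₁ * σ) * c
      + σ * ((a₁ + r₁ * c) ^ 2 - (b₁ + r₁ * σ) ^ 2))
    - (b + r * σ) ^ 5

/-- A fifth power of `b + r sin t` is not a trigonometric polynomial of degree at most three. -/
lemma eq_zero_of_meanPoly_eq_zero {b r a₁ b₁ r₁ a₂ b₂ r₂ : ℝ}
    (h : ∀ c σ : ℝ, c ^ 2 + σ ^ 2 = 1 → meanPoly b r a₁ b₁ r₁ a₂ b₂ r₂ c σ = 0) : r = 0 := by
  have p₁ := h 0 1 (by norm_num)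
  have p₂ := h 0 (-1) (by norm_num)
  have q₁ := h (4 / 5) (3 / 5) (by norm_num)
  have q₂ := h (-4 / 5) (3 / 5) (by norm_num)
  have q₃ := h (4 / 5) (-3 / 5) (by norm_num)
  have q₄ := h (-4 / 5) (-3 / 5) (by norm_num)
  have u₁ := h (3 / 5) (4 / 5) (by norm_num)
  have u₂ := h (-3 / 5) (4 / 5) (by norm_num)
  have u₃ := h (3 / 5) (-4 / 5) (by norm_num)
  have u₄ := h (-3 / 5) (-4 / 5) (by norm_num)
  simp only [meanPoly] at *
  have h5 : r ^ 5 = 0 := by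
    linear_combination (-1 : ℝ) * ((p₁ - p₂) / 2 / ((1 - 9 / 25) * (1 - 16 / 25))
      + (q₁ + q₂ - q₃ - q₄) / 4 / (3 / 5 * ((9 / 25 - 1) * (9 / 25 - 16 / 25)))
      + (u₁ + u₂ - u₃ - u₄) / 4 / (4 / 5 * ((16 / 25 - 1) * (16 / 25 - 9 / 25))))
  exact pow_eq_zero_iff (by norm_num) |>.1 h5

lemma exists_cos_eq_and_sin_eq {c σ : ℝ} (h : c ^ 2 + σ ^ 2 = 1) :
    ∃ t : ℝ, cos t = c ∧ sin t = σ := by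
  have hn : ‖(⟨c, σ⟩ : ℂ)‖ = 1 := by
    rw [← sq_eq_sq₀ (norm_nonneg _) zero_le_one, Complex.sq_norm, Complex.normSq_mk]
    linarith
  have h0 : (⟨c, σ⟩ : ℂ) ≠ 0 := norm_ne_zero_iff.1 (by rw [hn]; exact one_ne_zero)
  exact ⟨Complex.arg ⟨c, σ⟩, by simp [Complex.cos_arg h0, hn], by simp [Complex.sin_arg, hn]⟩

/-- A polynomial relation between `cos t` and `sin t` valid on an open set of parameters holds on
the whole unit circle. -/
lemma meanPoly_eq_zero_of_isOpen {J : Set ℝ} (hJo : IsOpen J) (hJne : J.Nonempty)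
    {b r a₁ b₁ r₁ a₂ b₂ r₂ : ℝ}
    (h : ∀ t ∈ J, meanPoly b r a₁ b₁ r₁ a₂ b₂ r₂ (cos t) (sin t) = 0)
    {c σ : ℝ} (hcσ : c ^ 2 + σ ^ 2 = 1) : meanPoly b r a₁ b₁ r₁ a₂ b₂ r₂ c σ = 0 := by
  obtain ⟨t, rfl, rfl⟩ := exists_cos_eq_and_sin_eq hcσ
  obtain ⟨t₀, ht₀⟩ := hJne
  have han : AnalyticOnNhd ℝ
      (fun t => meanPoly b r a₁ b₁ r₁ a₂ b₂ r₂ (cos t) (sin t)) Set.univ := by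
    intro x _
    have hc : AnalyticAt ℝ cos x := analyticAt_cos
    have hs : AnalyticAt ℝ sin x := analyticAt_sin
    unfold meanPoly
    fun_prop
  exact han.eqOn_zero_of_preconnected_of_eventuallyEq_zero isPreconnected_univ (Set.mem_univ t₀)
    (Filter.mem_of_superset (hJo.mem_nhds ht₀) h) (Set.mem_univ t)

lemma exp_two_mul_log {w : ℝ} (hw : 0 < w) : exp (2 * log w) = w ^ 2 := by
  rw [two_mul, exp_add, exp_log hw, sq]

section Derivatives

variable {I : Set ℝ} {f : ℝ → ℝ} {s : ℝ}

lemma hasDerivAt_of_contDiffOn_two (hI : IsOpen I) (hf : ContDiffOn ℝ 2 f I) (hs : s ∈ I) :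
    HasDerivAt f (deriv f s) s :=
  ((hf.contDiffAt (hI.mem_nhds hs)).differentiableAt (by norm_num)).hasDerivAt

lemma hasDerivAt_deriv_of_contDiffOn_two (hI : IsOpen I) (hf : ContDiffOn ℝ 2 f I) (hs : s ∈ I) :
    HasDerivAt (deriv f) (deriv (deriv f) s) s :=
  (((hf.deriv_of_isOpen hI (m := 1) (by norm_num)).contDiffAt
    (hI.mem_nhds hs)).differentiableAt (by norm_num)).hasDerivAt

end Derivatives

section Surface

variable {I : Set ℝ} {a b r : ℝ → ℝ} {s : ℝ}

lemma add_mul_sin_pos {b r : ℝ} (hr : 0 < r) (hbr : 0 < b - r) (t : ℝ) : 0 < b + r * sin t := by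
  nlinarith [neg_one_le_sin t]

lemma pXs_cyclic (hI : IsOpen I) (ha : ContDiffOn ℝ 2 a I) (hb : ContDiffOn ℝ 2 b I)
    (hr : ContDiffOn ℝ 2 r I) (hs : s ∈ I) (t : ℝ) (hw : 0 < b s + r s * sin t) :
    pXs (fun s t => (s, a s + r s * cos t, log (b s + r s * sin t))) s t =
      (1, deriv a s + deriv r s * cos t,
        (deriv b s + deriv r s * sin t) / (b s + r s * sin t)) := by
  have ha' := hasDerivAt_of_contDiffOn_two hI ha hs
  have hb' := hasDerivAt_of_contDiffOn_two hI hb hs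
  have hr' := hasDerivAt_of_contDiffOn_two hI hr hs
  exact ((hasDerivAt_id s).prodMk ((ha'.add (hr'.mul_const _)).prodMk
    ((hb'.add (hr'.mul_const _)).log hw.ne'))).deriv

lemma deriv_pXs_left_cyclic (hI : IsOpen I) (ha : ContDiffOn ℝ 2 a I) (hb : ContDiffOn ℝ 2 b I)
    (hr : ContDiffOn ℝ 2 r I) (hs : s ∈ I) (t : ℝ) (hw : ∀ s ∈ I, 0 < b s + r s * sin t) :
    deriv (fun s' => pXs (fun s t => (s, a s + r s * cos t, log (b s + r s * sin t))) s' t) s =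
      (0, deriv (deriv a) s + deriv (deriv r) s * cos t,
        ((deriv (deriv b) s + deriv (deriv r) s * sin t) * (b s + r s * sin t) -
          (deriv b s + deriv r s * sin t) * (deriv b s + deriv r s * sin t)) /
          (b s + r s * sin t) ^ 2) := by
  have heq : (fun s' => pXs (fun s t => (s, a s + r s * cos t, log (b s + r s * sin t))) s' t)
      =ᶠ[nhds s] fun s => (1, deriv a s + deriv r s * cos t,
        (deriv b s + deriv r s * sin t) / (b s + r s * sin t)) :=
    Filter.mem_of_superset (hI.mem_nhds hs)
      fun s' hs' => pXs_cyclic hI ha hb hr hs' t (hw s' hs')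
  rw [heq.deriv_eq]
  have hb' := hasDerivAt_of_contDiffOn_two hI hb hs
  have hr' := hasDerivAt_of_contDiffOn_two hI hr hs
  have ha'' := hasDerivAt_deriv_of_contDiffOn_two hI ha hs
  have hb'' := hasDerivAt_deriv_of_contDiffOn_two hI hb hs
  have hr'' := hasDerivAt_deriv_of_contDiffOn_two hI hr hs
  exact ((hasDerivAt_const s (1 : ℝ)).prodMk ((ha''.add (hr''.mul_const _)).prodMk
    ((hb''.add (hr''.mul_const _)).div (hb'.add (hr'.mul_const _)) (hw s hs).ne'))).deriv

lemma deriv_pXs_right_cyclic (hI : IsOpen I) (ha : ContDiffOn ℝ 2 a I) (hb : ContDiffOn ℝ 2 b I)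
    (hr : ContDiffOn ℝ 2 r I) (hs : s ∈ I) (t : ℝ) (hw : ∀ t, 0 < b s + r s * sin t) :
    deriv (fun t' => pXs (fun s t => (s, a s + r s * cos t, log (b s + r s * sin t))) s t') t =
      (0, deriv r s * -sin t,
        ((deriv r s * cos t) * (b s + r s * sin t) -
          (deriv b s + deriv r s * sin t) * (r s * cos t)) / (b s + r s * sin t) ^ 2) := by
  simp_rw [fun t' => pXs_cyclic hI ha hb hr hs t' (hw t')]
  exact ((hasDerivAt_const t (1 : ℝ)).prodMk
    ((((hasDerivAt_cos t).const_mul _).const_add _).prodMk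
    ((((hasDerivAt_sin t).const_mul _).const_add _).div
      (((hasDerivAt_sin t).const_mul _).const_add _) (hw t).ne'))).deriv

lemma pXt_cyclic (t : ℝ) (hw : 0 < b s + r s * sin t) :
    pXt (fun s t => (s, a s + r s * cos t, log (b s + r s * sin t))) s t =
      (0, r s * -sin t, (r s * cos t) / (b s + r s * sin t)) :=
  ((hasDerivAt_const t s).prodMk ((((hasDerivAt_cos t).const_mul _).const_add _).prodMk
    ((((hasDerivAt_sin t).const_mul _).const_add _).log hw.ne'))).deriv

lemma deriv_pXt_cyclic (t : ℝ) (hw : ∀ t, 0 < b s + r s * sin t) :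
    deriv (fun t' => pXt (fun s t => (s, a s + r s * cos t, log (b s + r s * sin t))) s t') t =
      (0, r s * -cos t,
        ((r s * -sin t) * (b s + r s * sin t) - (r s * cos t) * (r s * cos t)) /
          (b s + r s * sin t) ^ 2) := by
  simp_rw [fun t' => pXt_cyclic (a := a) t' (hw t')]
  exact ((hasDerivAt_const t (0 : ℝ)).prodMk (((hasDerivAt_sin t).neg.const_mul _).prodMk
    (((hasDerivAt_cos t).const_mul _).div
      (((hasDerivAt_sin t).const_mul _).const_add _) (hw t).ne'))).deriv

end Surface

/-- There are no minimal cyclic surfaces in Sol₃ foliated by arcs of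
circles in the totally geodesic planes `x = const`. -/
theorem no_minimal_cyclic_surfaces
    (I J : Set ℝ) (hIo : IsOpen I) (hIne : I.Nonempty) (hIc : I.OrdConnected)
    (hJo : IsOpen J) (hJne : J.Nonempty) (hJc : J.OrdConnected)
    (a b r : ℝ → ℝ)
    (ha : ContDiffOn ℝ 2 a I) (hb : ContDiffOn ℝ 2 b I) (hr : ContDiffOn ℝ 2 r I)
    (hrpos : ∀ s ∈ I, 0 < r s) (hbr : ∀ s ∈ I, 0 < b s - r s) :
    ¬ MeanZero I J (fun s t => (s, a s + r s * cos t, log (b s + r s * sin t))) := by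
  intro H
  obtain ⟨s, hs⟩ := hIne
  have hw : ∀ s ∈ I, ∀ t, 0 < b s + r s * sin t :=
    fun s hs t => add_mul_sin_pos (hrpos s hs) (hbr s hs) t
  refine (hrpos s hs).ne' (eq_zero_of_meanPoly_eq_zero (b := b s) (a₁ := deriv a s)
    (b₁ := deriv b s) (r₁ := deriv r s) (a₂ := deriv (deriv a) s) (b₂ := deriv (deriv b) s)
    (r₂ := deriv (deriv r) s)
    fun c σ hcσ => meanPoly_eq_zero_of_isOpen hJo hJne (fun t ht => ?_) hcσ)
  have hwt := hw s hs t
  have hcs := sin_sq_add_cos_sq t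
  have key := H s hs t ht
    (-(deriv a s * cos t + deriv b s * sin t + deriv r s), cos t * (b s + r s * sin t) ^ 4,
      sin t * (b s + r s * sin t) ^ 3)
  simp only [Stt, Sst, Sss, pXs_cyclic hIo ha hb hr hs t hwt, pXt_cyclic t hwt,
    deriv_pXs_left_cyclic hIo ha hb hr hs t fun s hs => hw s hs t,
    deriv_pXs_right_cyclic hIo ha hb hr hs t (hw s hs), deriv_pXt_cyclic t (hw s hs),
    gSol, GammaSol, exp_neg, exp_two_mul_log hwt, Prod.fst_add, Prod.snd_add] at key
  have hr0 := (hrpos s hs).ne'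
  unfold meanPoly
  generalize deriv (deriv a) s = a₂ at *
  generalize deriv (deriv b) s = b₂ at *
  generalize deriv (deriv r) s = r₂ at *
  generalize deriv a s = a₁ at *
  generalize deriv b s = b₁ at *
  generalize deriv r s = r₁ at *
  generalize r s = r₀ at *
  generalize cos t = c at *
  generalize sin t = σ at *
  obtain ⟨w, hwdef⟩ : ∃ w, w = b s + r₀ * σ := ⟨_, rfl⟩
  have hbs : b s = w - r₀ * σ := by linarith
  rw [← hwdef] at key hwt ⊢
  rw [hbs]
  have hw0 := hwt.ne'
  specialize key ?_ ?_
  · field_simp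
    linear_combination (r₁ * w ^ 2) * hcs
  · field_simp
    ring
  field_simp at key
  refine mul_left_cancel₀ hr0 ?_
  linear_combination key
    + (w ^ 4 + (a₁ + r₁ * c) ^ 2 + (b₁ + r₁ * σ) ^ 2) * r₀ * (w - r₀ * σ) * hcs
    - 2 * r₀ ^ 2 * ((b₁ + r₁ * σ) * c - (a₁ + r₁ * c) * σ) * (a₁ + r₁ * c) * hcs
    - r₀ ^ 2 * w * r₂ * hcs
    - r₀ ^ 2 * (-2 * (a₁ * c + b₁ * σ + r₁) * (b₁ + r₁ * σ)
      + c * (w * (a₂ + c * r₂) - 2 * (a₁ + r₁ * c) * (b₁ + r₁ * σ))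
      + σ * (w * (b₂ + σ * r₂) - (b₁ + r₁ * σ) ^ 2 - w ^ 4 + (a₁ + r₁ * c) ^ 2)) * hcs
end
end

section
/- There are no flat surfaces in Sol₃ foliated by arcs of circles in the horizontal planes z = const. Precisely: let I, J ⊆ ℝ be nonempty open intervals and let a, b, r : I → ℝ be twice continuously differentiable with r(s) > 0 for all s ∈ I, and define X : I × J → ℝ³ by X(s,t) = (a(s) + r(s)·e^{−s}·cos t, b(s) + r(s)·e^{s}·sin t, s). Then X does not have zero Gaussian curvature, i.e. it is NOT the case that for every (s,t) ∈ I × J and every n ∈ ℝ³ with g_X(n, X_s) = g_X(n, X_t) = 0 one has g_X(S_ss, n)·g_X(S_tt, n) − g_X(S_st, n)² = 0. -/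
open Real

noncomputable section

/-- The vector with components `u₁, u₂, u₃` in the left-invariant orthonormal frame
`(e^{-z}∂x, e^z∂y, ∂z)` at height `z`. -/
def frameVec (z u₁ u₂ u₃ : ℝ) : V3 := (exp (-z) * u₁, exp z * u₂, u₃)

lemma frameVec_add (z u₁ u₂ u₃ v₁ v₂ v₃ : ℝ) :
    frameVec z u₁ u₂ u₃ + frameVec z v₁ v₂ v₃ = frameVec z (u₁ + v₁) (u₂ + v₂) (u₃ + v₃) := by
  simp [frameVec, mul_add]

lemma gSol_frameVec (x y z u₁ u₂ u₃ v₁ v₂ v₃ : ℝ) :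
    gSol (x, y, z) (frameVec z u₁ u₂ u₃) (frameVec z v₁ v₂ v₃)
      = u₁ * v₁ + u₂ * v₂ + u₃ * v₃ := by
  have h₁ : exp (2 * z) = exp z * exp z := by rw [← exp_add]; ring_nf
  have hz := (exp_pos z).ne'
  simp only [gSol, frameVec, exp_neg, h₁]
  field_simp

lemma GammaSol_frameVec (x y z u₁ u₂ u₃ v₁ v₂ v₃ : ℝ) :
    GammaSol (x, y, z) (frameVec z u₁ u₂ u₃) (frameVec z v₁ v₂ v₃)
      = frameVec z (u₁ * v₃ + u₃ * v₁) (-(u₂ * v₃ + u₃ * v₂)) (-(u₁ * v₁) + u₂ * v₂) := by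
  have h₁ : exp (2 * z) = exp z * exp z := by rw [← exp_add]; ring_nf
  have hz := (exp_pos z).ne'
  simp only [GammaSol, frameVec, exp_neg, h₁, Prod.mk.injEq]
  refine ⟨?_, ?_, ?_⟩ <;> field_simp

/-- A surface foliated by circles of the horizontal planes `z = s`. -/
def circleSurface (a b r : ℝ → ℝ) (s t : ℝ) : V3 :=
  (a s + r s * exp (-s) * cos t, b s + r s * exp s * sin t, s)

lemma pXt_circleSurface (a b r : ℝ → ℝ) (s t : ℝ) :
    pXt (circleSurface a b r) s t = frameVec s (-(r s * sin t)) (r s * cos t) 0 := by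
  have h := (((hasDerivAt_cos t).const_mul (r s * exp (-s))).const_add (a s)).prodMk
    ((((hasDerivAt_sin t).const_mul (r s * exp s)).const_add (b s)).prodMk
      (hasDerivAt_const t s))
  refine h.deriv.trans ?_
  simp only [frameVec, Prod.mk.injEq]
  refine ⟨?_, ?_, trivial⟩ <;> ring

lemma pXs_circleSurface {a b r : ℝ → ℝ} {s a' b' r' : ℝ} (ha : HasDerivAt a a' s)
    (hb : HasDerivAt b b' s) (hr : HasDerivAt r r' s) (t : ℝ) :
    pXs (circleSurface a b r) s t
      = (a' + (r' - r s) * exp (-s) * cos t, b' + (r' + r s) * exp s * sin t, 1) := by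
  have h := (ha.add ((hr.mul (hasDerivAt_neg s).exp).mul_const (cos t))).prodMk
    ((hb.add ((hr.mul (hasDerivAt_exp s)).mul_const (sin t))).prodMk (hasDerivAt_id s))
  refine h.deriv.trans ?_
  simp only [Prod.mk.injEq]
  refine ⟨?_, ?_, trivial⟩ <;> ring

lemma Stt_circleSurface (a b r : ℝ → ℝ) (s t : ℝ) :
    Stt (circleSurface a b r) s t
      = frameVec s (-(r s * cos t)) (-(r s * sin t)) (r s ^ 2 * (cos t ^ 2 - sin t ^ 2)) := by
  have h : HasDerivAt (fun t' => pXt (circleSurface a b r) s t')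
      (frameVec s (-(r s * cos t)) (r s * -sin t) 0) t := by
    simp only [pXt_circleSurface]
    exact (((hasDerivAt_sin t).const_mul (r s)).neg.const_mul (exp (-s))).prodMk
      ((((hasDerivAt_cos t).const_mul (r s)).const_mul (exp s)).prodMk (hasDerivAt_const t 0))
  rw [Stt, h.deriv, pXt_circleSurface, circleSurface, GammaSol_frameVec, frameVec_add]
  congr 1 <;> ring

lemma Sst_circleSurface {a b r : ℝ → ℝ} {s A B r' : ℝ} (ha : HasDerivAt a (exp (-s) * A) s)
    (hb : HasDerivAt b (exp s * B) s) (hr : HasDerivAt r r' s) (t : ℝ) :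
    Sst (circleSurface a b r) s t
      = frameVec s (-(r' * sin t)) (r' * cos t)
        (r s * (A * sin t + B * cos t + 2 * r' * sin t * cos t)) := by
  have h : HasDerivAt (fun t' => pXs (circleSurface a b r) s t')
      (frameVec s (-((r' - r s) * sin t)) ((r' + r s) * cos t) 0) t := by
    simp only [pXs_circleSurface ha hb hr]
    convert (((hasDerivAt_cos t).const_mul ((r' - r s) * exp (-s))).const_add
      (exp (-s) * A)).prodMk ((((hasDerivAt_sin t).const_mul ((r' + r s) * exp s)).const_add
      (exp s * B)).prodMk (hasDerivAt_const t (1 : ℝ))) using 1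
    simp only [frameVec, Prod.mk.injEq]
    refine ⟨?_, ?_, trivial⟩ <;> ring
  have hs : pXs (circleSurface a b r) s t
      = frameVec s (A + (r' - r s) * cos t) (B + (r' + r s) * sin t) 1 := by
    rw [pXs_circleSurface ha hb hr]
    simp only [frameVec, Prod.mk.injEq]
    refine ⟨?_, ?_, trivial⟩ <;> ring
  rw [Sst, h.deriv, hs, pXt_circleSurface, circleSurface, GammaSol_frameVec, frameVec_add]
  congr 1 <;> ring

lemma Sss_circleSurface {a b r : ℝ → ℝ} {I : Set ℝ} (hI : IsOpen I)
    (ha : ContDiffOn ℝ 2 a I) (hb : ContDiffOn ℝ 2 b I) (hr : ContDiffOn ℝ 2 r I)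
    {s A B : ℝ} (hs : s ∈ I) (hA : deriv a s = exp (-s) * A) (hB : deriv b s = exp s * B) :
    ∃ P Q R : ℝ, ∀ t, Sss (circleSurface a b r) s t
      = frameVec s (P + R * cos t) (Q + R * sin t)
        ((B + (deriv r s + r s) * sin t) ^ 2 - (A + (deriv r s - r s) * cos t) ^ 2) := by
  have key : ∀ {f : ℝ → ℝ}, ContDiffOn ℝ 2 f I →
      (∀ s' ∈ I, HasDerivAt f (deriv f s') s') ∧
        HasDerivAt (deriv f) (deriv (deriv f) s) s := by
    intro f hf
    refine ⟨fun s' hs' => ((hf.differentiableOn (by norm_num)).differentiableAt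
      (hI.mem_nhds hs')).hasDerivAt, ?_⟩
    have h₁ : ContDiffOn ℝ 1 (deriv f) I := hf.deriv_of_isOpen hI (by norm_num)
    exact ((h₁.differentiableOn (by norm_num)).differentiableAt (hI.mem_nhds hs)).hasDerivAt
  obtain ⟨ha₁, ha₂⟩ := key ha
  obtain ⟨hb₁, hb₂⟩ := key hb
  obtain ⟨hr₁, hr₂⟩ := key hr
  refine ⟨exp s * deriv (deriv a) s + 2 * A, exp (-s) * deriv (deriv b) s - 2 * B,
    deriv (deriv r) s - r s, fun t => ?_⟩
  have hX : pXs (circleSurface a b r) s t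
      = frameVec s (A + (deriv r s - r s) * cos t) (B + (deriv r s + r s) * sin t) 1 := by
    rw [pXs_circleSurface (ha₁ s hs) (hb₁ s hs) (hr₁ s hs), hA, hB]
    simp only [frameVec, Prod.mk.injEq]
    refine ⟨?_, ?_, trivial⟩ <;> ring
  have hev : (fun s' => pXs (circleSurface a b r) s' t) =ᶠ[nhds s] fun s' =>
      (deriv a s' + (deriv r s' - r s') * exp (-s') * cos t,
        deriv b s' + (deriv r s' + r s') * exp s' * sin t, 1) := by
    filter_upwards [hI.mem_nhds hs] with s' hs'
    exact pXs_circleSurface (ha₁ s' hs') (hb₁ s' hs') (hr₁ s' hs') t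
  have h := (ha₂.add (((hr₂.sub (hr₁ s hs)).mul (hasDerivAt_neg s).exp).mul_const (cos t))).prodMk
    ((hb₂.add (((hr₂.add (hr₁ s hs)).mul (hasDerivAt_exp s)).mul_const (sin t))).prodMk
      (hasDerivAt_const s (1 : ℝ)))
  have h' : deriv (fun s' => pXs (circleSurface a b r) s' t) s
      = frameVec s
        (exp s * deriv (deriv a) s + (deriv (deriv r) s - 2 * deriv r s + r s) * cos t)
        (exp (-s) * deriv (deriv b) s + (deriv (deriv r) s + 2 * deriv r s + r s) * sin t) 0 := by
    refine hev.deriv_eq.trans (h.deriv.trans ?_)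
    have hz := (exp_pos s).ne'
    simp only [frameVec, Prod.mk.injEq, exp_neg]
    refine ⟨?_, ?_, trivial⟩ <;> simp <;> field_simp <;> ring
  rw [Sss, h', hX, circleSurface, GammaSol_frameVec, frameVec_add]
  congr 1 <;> ring

open Polynomial in
/-- The trigonometric polynomial expressing flatness along a horizontal circle has a non-vanishing
term of degree eight, so it cannot vanish at infinitely many points of the circle. -/
lemma not_flat_trigPolynomial {J : Set ℝ} (hJ : IsOpen J) (hJne : J.Nonempty)
    {r : ℝ} (hr : r ≠ 0) (A B r' P Q R : ℝ) :
    ¬ ∀ t ∈ J, ∀ N, N = A * cos t + B * sin t + r' - r * (cos t ^ 2 - sin t ^ 2) →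
      (P * cos t + Q * sin t + R
          - N * ((B + (r' + r) * sin t) ^ 2 - (A + (r' - r) * cos t) ^ 2))
        * (1 + r * (cos t ^ 2 - sin t ^ 2) * N)
      + r * N ^ 2 * (A * sin t + B * cos t + 2 * r' * sin t * cos t) ^ 2 = 0 := by
  intro H
  obtain ⟨t₀, ht₀⟩ := hJne
  let c : ℂ[X] := X ^ 2 + 1
  let d : ℂ[X] := -C Complex.I * (X ^ 2 - 1)
  let e : ℂ[X] := X ^ 4 + 1
  let n : ℂ[X] := C (A : ℂ) * X * c + C (B : ℂ) * X * d + 2 * C (r' : ℂ) * X ^ 2 - C (r : ℂ) * e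
  let w : ℂ[X] := (2 * C (B : ℂ) * X + C (r' + r : ℂ) * d) ^ 2
    - (2 * C (A : ℂ) * X + C (r' - r : ℂ) * c) ^ 2
  let m : ℂ[X] := C (A : ℂ) * X * d + C (B : ℂ) * X * c - C (r' : ℂ) * C Complex.I * (X ^ 4 - 1)
  let l : ℂ[X] := C (P : ℂ) * X * c + C (Q : ℂ) * X * d + 2 * C (R : ℂ) * X ^ 2
  let p : ℂ[X] := (4 * X ^ 2 * l - n * w) * (4 * X ^ 4 + C (r : ℂ) * e * n)
    + 2 * C (r : ℂ) * n ^ 2 * m ^ 2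
  have hroot : ∀ t ∈ J, p.eval (Complex.exp (t * Complex.I)) = 0 := by
    intro t ht
    have h := congrArg (fun x : ℝ => (x : ℂ)) (H t ht _ rfl)
    push_cast at h
    generalize hz : Complex.exp (t * Complex.I) = z
    have hi : Complex.I ^ 2 = -1 := Complex.I_sq
    have hzz : z = Complex.cos t + Complex.sin t * Complex.I := by rw [← hz, Complex.exp_mul_I]
    have hcs := Complex.cos_sq_add_sin_sq (t : ℂ)
    generalize Complex.cos (t : ℂ) = x at *
    generalize Complex.sin (t : ℂ) = y at *
    have hc : z ^ 2 + 1 = 2 * z * x := by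
      rw [hzz]; linear_combination y ^ 2 * hi - hcs
    have hd : -Complex.I * (z ^ 2 - 1) = 2 * z * y := by
      rw [hzz]; linear_combination (-2 * x * y - Complex.I * y ^ 2) * hi - Complex.I * hcs
    have he : z ^ 4 + 1 = 2 * z ^ 2 * (x ^ 2 - y ^ 2) := by
      linear_combination (z ^ 2 + 1 + 2 * z * x) / 2 * hc
        - (-Complex.I * (z ^ 2 - 1) + 2 * z * y) / 2 * hd + (z ^ 2 - 1) ^ 2 / 2 * hi
    have hf : -Complex.I * (z ^ 4 - 1) = 4 * z ^ 2 * x * y := by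
      linear_combination -Complex.I * (z ^ 2 - 1) * hc + 2 * z * x * hd
    have hn : n.eval z = 2 * z ^ 2 * (A * x + B * y + r' - r * (x ^ 2 - y ^ 2)) := by
      simp only [n, c, d, e, eval_add, eval_sub, eval_mul, eval_pow, eval_X, eval_C, eval_one,
        eval_neg, eval_ofNat]
      linear_combination A * z * hc + B * z * hd - r * he
    have hw : w.eval z = 4 * z ^ 2 * ((B + (r' + r) * y) ^ 2 - (A + (r' - r) * x) ^ 2) := by
      simp only [w, c, d, eval_add, eval_sub, eval_mul, eval_pow, eval_X, eval_C, eval_one,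
        eval_neg, eval_ofNat]
      rw [hc, hd]; ring
    have hm : m.eval z = 2 * z ^ 2 * (A * y + B * x + 2 * r' * y * x) := by
      simp only [m, c, d, eval_add, eval_sub, eval_mul, eval_pow, eval_X, eval_C, eval_one,
        eval_neg]
      linear_combination A * z * hd + B * z * hc + r' * hf
    have hl : l.eval z = 2 * z ^ 2 * (P * x + Q * y + R) := by
      simp only [l, c, d, eval_add, eval_sub, eval_mul, eval_pow, eval_X, eval_C, eval_one,
        eval_neg, eval_ofNat]
      linear_combination P * z * hc + Q * z * hd
    have he' : e.eval z = 2 * z ^ 2 * (x ^ 2 - y ^ 2) := by simpa [e] using he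
    simp only [p, eval_add, eval_sub, eval_mul, eval_pow, eval_X, eval_C, eval_ofNat,
      hn, hw, hm, hl, he']
    linear_combination 32 * z ^ 8 * h
  have hinf : (J ∩ Set.Ioo (t₀ - π) (t₀ + π)).Infinite :=
    infinite_of_mem_nhds t₀ (Filter.inter_mem (hJ.mem_nhds ht₀)
      (Ioo_mem_nhds (by linarith [pi_pos]) (by linarith [pi_pos])))
  have hinj : Set.InjOn (fun t : ℝ => Complex.exp (t * Complex.I))
      (J ∩ Set.Ioo (t₀ - π) (t₀ + π)) := by
    rintro u ⟨-, hu⟩ v ⟨-, hv⟩ h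
    obtain ⟨k, hk⟩ := Complex.exp_eq_exp_iff_exists_int.mp h
    have hk' : u = v + k * (2 * π) := by simpa using congrArg Complex.im hk
    have h₁ : (k : ℝ) < 1 := by nlinarith [pi_pos, hu.2, hv.1]
    have h₂ : (-1 : ℝ) < k := by nlinarith [pi_pos, hu.1, hv.2]
    have h₃ : k < 1 := by exact_mod_cast h₁
    have h₄ : -1 < k := by exact_mod_cast h₂
    obtain rfl : k = 0 := by omega
    simpa using hk'
  have hp : p = 0 := by
    refine eq_zero_of_infinite_isRoot p ((hinf.image hinj).mono ?_)
    rintro _ ⟨t, ht, rfl⟩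
    exact hroot t ht.1
  have h₀ : p.eval 0 = 2 * (r : ℂ) ^ 5 := by
    simp only [p, n, w, m, l, c, d, e, eval_add, eval_sub, eval_mul, eval_pow, eval_X, eval_C,
      eval_one, eval_neg, eval_ofNat]
    linear_combination (-(r : ℂ) ^ 3 * (r' + r) ^ 2 + 2 * r ^ 3 * r' ^ 2) * Complex.I_sq
  rw [hp, eval_zero] at h₀
  simp [hr] at h₀

/-- There are no flat surfaces in Sol₃ foliated by arcs of circles
in the horizontal planes `z = const`. -/
theorem no_flat_cyclic_surfaces_horizontal
    (I J : Set ℝ) (hIo : IsOpen I) (hIne : I.Nonempty) (hIc : I.OrdConnected)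
    (hJo : IsOpen J) (hJne : J.Nonempty) (hJc : J.OrdConnected)
    (a b r : ℝ → ℝ)
    (ha : ContDiffOn ℝ 2 a I) (hb : ContDiffOn ℝ 2 b I) (hr : ContDiffOn ℝ 2 r I)
    (hrpos : ∀ s ∈ I, 0 < r s) :
    ¬ GaussZero I J
      (fun s t => (a s + r s * exp (-s) * cos t, b s + r s * exp s * sin t, s)) := by
  intro H
  obtain ⟨s, hs⟩ := hIne
  have hd : ∀ {f : ℝ → ℝ}, ContDiffOn ℝ 2 f I → HasDerivAt f (deriv f s) s := fun hf =>
    ((hf.differentiableOn (by norm_num)).differentiableAt (hIo.mem_nhds hs)).hasDerivAt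
  obtain ⟨A, hA⟩ : ∃ A, deriv a s = exp (-s) * A :=
    ⟨deriv a s / exp (-s), by field_simp⟩
  obtain ⟨B, hB⟩ : ∃ B, deriv b s = exp s * B :=
    ⟨deriv b s / exp s, by field_simp⟩
  obtain ⟨P, Q, R, hSss⟩ := Sss_circleSurface hIo ha hb hr hs hA hB
  have ha' := hd ha
  have hb' := hd hb
  rw [hA] at ha'
  rw [hB] at hb'
  refine not_flat_trigPolynomial hJo hJne (hrpos s hs).ne' A B (deriv r s) P Q R
    fun t ht N hN => ?_
  have hcs := cos_sq_add_sin_sq t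
  have hXs : pXs (circleSurface a b r) s t
      = frameVec s (A + (deriv r s - r s) * cos t) (B + (deriv r s + r s) * sin t) 1 := by
    rw [pXs_circleSurface ha' hb' (hd hr)]
    simp only [frameVec, Prod.mk.injEq]
    refine ⟨?_, ?_, trivial⟩ <;> ring
  have h := H s hs t ht (frameVec s (cos t) (sin t) (-N))
  change gSol (circleSurface a b r s t) _ (pXs (circleSurface a b r) s t) = 0 →
    gSol (circleSurface a b r s t) _ (pXt (circleSurface a b r) s t) = 0 →
    gSol (circleSurface a b r s t) (Sss (circleSurface a b r) s t) _
      * gSol (circleSurface a b r s t) (Stt (circleSurface a b r) s t) _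
      - gSol (circleSurface a b r s t) (Sst (circleSurface a b r) s t) _ ^ 2 = 0 at h
  rw [hXs, pXt_circleSurface, hSss, Stt_circleSurface, Sst_circleSurface ha' hb' (hd hr),
    circleSurface] at h
  simp only [gSol_frameVec] at h
  have h₁ := h (by rw [hN]; linear_combination deriv r s * hcs) (by ring)
  have h₂ : (P + R * cos t) * cos t + (Q + R * sin t) * sin t
      = P * cos t + Q * sin t + R := by linear_combination R * hcs
  have h₃ : -(r s * cos t) * cos t + -(r s * sin t) * sin t = -r s := by
    linear_combination -r s * hcs
  have h₄ : -(deriv r s * sin t) * cos t + deriv r s * cos t * sin t = 0 := by ring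
  rw [h₂, h₃, h₄] at h₁
  refine (mul_eq_zero.mp ?_).resolve_left (hrpos s hs).ne'
  linear_combination -h₁
end
end
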